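/- Let 𝕂 = ℝ or 𝕂 = ℂ, let M be a compact Hausdorff space such that C(M;ℂ) is isometrically isomorphic as a complex Banach algebra to L^∞(𝕋), and let ι be a nonempty type of cardinality at most 𝔠. Then C((M × 𝕋^ι) ⊕ OnePoint ℕ; 𝕂) admits an isometric shift, where 𝕋^ι = (ι → 𝕋) carries the product topology. -/

import Mathlib

open Topology

/-- `T` is an isometric shift: an isometry whose range has codimension 1 and with
`⋂_{n≥1} Tⁿ(E) = {0}`. -/
def IsIsometricShift {𝕜 E : Type*} [RCLike 𝕜] [NormedAddCommGroup E] [NormedSpace 𝕜 E]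
    (T : E →L[𝕜] E) : Prop :=
  (∀ f, ‖T f‖ = ‖f‖) ∧
    Module.rank 𝕜 (E ⧸ LinearMap.range (T : E →ₗ[𝕜] E)) = 1 ∧
    (⋂ n : ℕ, Set.range ((⇑T)^[n + 1])) = {0}

open MeasureTheory in
instance : Fact (0 < 2 * Real.pi) := ⟨by positivity⟩

open MeasureTheory in
/-- `C(M, ℂ)` is isometrically isomorphic, as a complex Banach algebra, to `L^∞(𝕋)`
(realized as `Lp ℂ ∞` of the circle `ℝ/2πℤ` with Lebesgue/Haar measure): there is a
complex-linear isometric equivalence which is moreover multiplicative (hence a Banach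
algebra isomorphism). -/
def IsCMIsoLinftyCircle (M : Type*) [TopologicalSpace M] [CompactSpace M] : Prop :=
  ∃ e : C(M, ℂ) ≃ₗᵢ[ℂ] Lp ℂ ⊤ (volume : Measure (AddCircle (2 * Real.pi))),
    ∀ f g : C(M, ℂ),
      ((e (f * g) : AddCircle (2 * Real.pi) →ₘ[volume] ℂ)) = ↑(e f) * ↑(e g)

section

open Filter

/-- Kronecker's theorem for a finite-dimensional torus. -/
theorem UnitAddTorus.denseRange_nsmul {d : Type*} [Fintype d] (r : UnitAddTorus d)
    (hr : ∀ n : d → ℤ, n ≠ 0 → UnitAddTorus.mFourier n r ≠ 1) :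
    DenseRange fun k : ℕ ↦ k • r := by
  classical
  let μ : MeasureTheory.Measure (UnitAddTorus d) := MeasureTheory.Measure.addHaarMeasure ⊤
  have hμ : MeasureTheory.IsProbabilityMeasure μ :=
    ⟨MeasureTheory.Measure.addHaarMeasure_self (K₀ := ⊤)⟩
  have hinteg (g : C(UnitAddTorus d, ℂ)) : MeasureTheory.Integrable g μ :=
    g.continuous.integrable_of_hasCompactSupport (HasCompactSupport.of_compactSpace _)
  have hmul (n : d → ℤ) (x y : UnitAddTorus d) : UnitAddTorus.mFourier n (x + y) =
      UnitAddTorus.mFourier n x * UnitAddTorus.mFourier n y := by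
    simp [UnitAddTorus.mFourier, Finset.prod_mul_distrib, smul_add, AddCircle.toCircle_add]
  have hone (n : d → ℤ) : UnitAddTorus.mFourier n (0 : UnitAddTorus d) = 1 := by
    simp [UnitAddTorus.mFourier]
  have hpow (n : d → ℤ) (k : ℕ) : UnitAddTorus.mFourier n (k • r) =
      UnitAddTorus.mFourier n r ^ k := by
    induction k with
    | zero => simp [hone]
    | succ k ih => rw [succ_nsmul, hmul, ih, pow_succ]
  have hmean : ∀ g : C(UnitAddTorus d, ℂ),
      Tendsto (fun N : ℕ ↦ (N : ℂ)⁻¹ * ∑ k ∈ Finset.range N, g (k • r)) atTop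
        (𝓝 (∫ x, g x ∂μ)) := by
    intro g
    have hg : g ∈ (Submodule.span ℂ
        (Set.range (UnitAddTorus.mFourier (d := d)))).topologicalClosure := by
      rw [UnitAddTorus.span_mFourier_closure_eq_top]; trivial
    have hspan : ∀ g ∈ Submodule.span ℂ (Set.range (UnitAddTorus.mFourier (d := d))),
        Tendsto (fun N : ℕ ↦ (N : ℂ)⁻¹ * ∑ k ∈ Finset.range N, g (k • r)) atTop
        (𝓝 (∫ x, g x ∂μ)) := by
      intro g hg
      induction hg using Submodule.span_induction with
      | mem x h =>
        obtain ⟨n, rfl⟩ := h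
        by_cases hn : n = 0
        · subst hn
          simp only [UnitAddTorus.mFourier_zero, ContinuousMap.one_apply]
          simp only [Finset.sum_const, Finset.card_range, nsmul_eq_mul, mul_one,
            MeasureTheory.integral_const, MeasureTheory.probReal_univ, one_smul]
          refine tendsto_const_nhds.congr' ?_
          filter_upwards [eventually_gt_atTop 0] with N hN
          rw [inv_mul_cancel₀]
          exact_mod_cast hN.ne'
        · have hz := hr n hn
          have h0 : ∫ x, UnitAddTorus.mFourier n x ∂μ = 0 := by
            have h1 := MeasureTheory.integral_add_right_eq_self (μ := μ)
              (UnitAddTorus.mFourier n) r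
            simp only [hmul] at h1
            rw [MeasureTheory.integral_mul_const] at h1
            have h2 : (∫ x, UnitAddTorus.mFourier n x ∂μ) *
                (UnitAddTorus.mFourier n r - 1) = 0 := by linear_combination h1
            exact (mul_eq_zero.1 h2).resolve_right (sub_ne_zero.2 hz)
          rw [h0]
          simp only [hpow, geom_sum_eq hz]
          have hz1 : ‖UnitAddTorus.mFourier n r‖ ≤ 1 := by
            simpa [UnitAddTorus.mFourier_norm] using
              (UnitAddTorus.mFourier n).norm_coe_le_norm r
          refine (tendsto_inv_atTop_nhds_zero_nat (𝕜 := ℂ)).zero_mul_isBoundedUnder_le ?_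
          refine isBoundedUnder_of ⟨2 / ‖UnitAddTorus.mFourier n r - 1‖, fun N ↦ ?_⟩
          simp only [Function.comp, norm_div]
          gcongr
          refine (norm_sub_le _ _).trans ?_
          have := pow_le_one₀ (n := N) (norm_nonneg _) hz1
          rw [norm_pow, norm_one]
          linarith
      | zero => simp
      | add x y _ _ hx hy =>
        simp only [ContinuousMap.add_apply, Finset.sum_add_distrib, mul_add]
        rw [MeasureTheory.integral_add (hinteg x) (hinteg y)]
        exact hx.add hy
      | smul a x _ hx =>
        simp only [ContinuousMap.smul_apply, smul_eq_mul, ← Finset.mul_sum]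
        rw [MeasureTheory.integral_const_mul]
        simpa only [mul_left_comm] using hx.const_mul a
    rw [Metric.tendsto_atTop]
    intro ε hε
    obtain ⟨g', hg', hd⟩ := Metric.mem_closure_iff.1 hg (ε / 3) (by positivity)
    obtain ⟨N₀, hN₀⟩ := Metric.tendsto_atTop.1 (hspan g' hg') (ε / 3) (by positivity)
    have hb (x) : ‖g x - g' x‖ ≤ ε / 3 := by
      rw [← dist_eq_norm]
      exact (ContinuousMap.dist_apply_le_dist x).trans hd.le
    refine ⟨N₀ + 1, fun N hN ↦ ?_⟩
    have h1 := hN₀ N (by omega)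
    have h2 : ‖(∫ x, g x ∂μ) - ∫ x, g' x ∂μ‖ ≤ ε / 3 := by
      rw [← MeasureTheory.integral_sub (hinteg g) (hinteg g')]
      simpa using MeasureTheory.norm_integral_le_of_norm_le_const (μ := μ)
        (MeasureTheory.ae_of_all _ hb)
    have hNpos : (0 : ℝ) < N := by
      have : 0 < N := by omega
      exact_mod_cast this
    have h3 : ‖(N : ℂ)⁻¹ * ∑ k ∈ Finset.range N, g (k • r) -
        (N : ℂ)⁻¹ * ∑ k ∈ Finset.range N, g' (k • r)‖ ≤ ε / 3 := by
      rw [← mul_sub, ← Finset.sum_sub_distrib, norm_mul, norm_inv, RCLike.norm_natCast,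
        inv_mul_le_iff₀ hNpos]
      refine (norm_sum_le_of_le _ fun k _ ↦ hb (k • r)).trans ?_
      simp
    rw [dist_eq_norm] at h1 ⊢
    have h4 := norm_add₃_le (a := (N : ℂ)⁻¹ * ∑ k ∈ Finset.range N, g (k • r) -
        (N : ℂ)⁻¹ * ∑ k ∈ Finset.range N, g' (k • r))
      (b := (N : ℂ)⁻¹ * ∑ k ∈ Finset.range N, g' (k • r) - ∫ x, g' x ∂μ)
      (c := -((∫ x, g x ∂μ) - ∫ x, g' x ∂μ))
    rw [norm_neg] at h4
    refine lt_of_eq_of_lt (congrArg norm ?_) (lt_of_le_of_lt h4 (by linarith))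
    ring
  by_contra hd
  obtain ⟨y, hy⟩ : ∃ y, y ∉ closure (Set.range fun k : ℕ ↦ k • r) := by
    simpa [DenseRange, Dense] using hd
  obtain ⟨g, hg0, hg1, hg⟩ := exists_continuous_zero_one_of_isClosed
    (isClosed_closure (s := Set.range fun k : ℕ ↦ k • r)) (isClosed_singleton (x := y))
    (Set.disjoint_singleton_right.2 hy)
  have h := hmean ((⟨_, Complex.continuous_ofReal⟩ : C(ℝ, ℂ)).comp g)
  have hgr (k : ℕ) : g (k • r) = 0 := hg0 (subset_closure ⟨k, rfl⟩)
  simp only [ContinuousMap.comp_apply, ContinuousMap.coe_mk, hgr, Complex.ofReal_zero,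
    Finset.sum_const_zero, mul_zero] at h
  have h0 := tendsto_nhds_unique tendsto_const_nhds h
  rw [integral_complex_ofReal] at h0
  have hpos : 0 < ∫ x, g x ∂μ :=
    g.continuous.integral_pos_of_hasCompactSupport_nonneg_nonzero
      (HasCompactSupport.of_compactSpace _) (fun x ↦ (hg x).1) (x := y)
      (by rw [hg1 rfl]; exact one_ne_zero)
  exact hpos.ne (by exact_mod_cast h0)

theorem exists_denseRange_nsmul (ι : Type) (hι : Cardinal.mk ι ≤ Cardinal.continuum) :
    ∃ r : ι → UnitAddCircle, DenseRange fun k : ℕ ↦ (2 * k) • r := by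
  classical
  obtain ⟨v, hv⟩ : ∃ v : Option ι → ℝ, LinearIndependent ℚ v := by
    let b := Module.Free.chooseBasis ℚ ℝ
    have hc : Cardinal.mk (Option ι) ≤ Cardinal.mk (Module.Free.ChooseBasisIndex ℚ ℝ) := by
      rw [← Module.Free.rank_eq_card_chooseBasisIndex, Real.rank_rat_real, Cardinal.mk_option]
      exact Cardinal.add_le_of_le Cardinal.aleph0_le_continuum hι
        (Cardinal.one_le_aleph0.trans Cardinal.aleph0_le_continuum)
    obtain ⟨j⟩ := hc
    exact ⟨b ∘ j, b.linearIndependent.comp j j.injective⟩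
  have hv0 : v none ≠ 0 := hv.ne_zero none
  refine ⟨fun i ↦ ((v (some i) / v none : ℝ) : UnitAddCircle), ?_⟩
  set r : ι → UnitAddCircle := fun i ↦ ((v (some i) / v none : ℝ) : UnitAddCircle)
  rw [DenseRange, dense_iff_inter_open]
  rintro U hU ⟨f, hf⟩
  obtain ⟨I, u, hu, hIU⟩ := isOpen_pi_iff.1 hU f hf
  have key : DenseRange fun k : ℕ ↦ k • (fun i : I ↦ 2 • r i) := by
    apply UnitAddTorus.denseRange_nsmul
    intro n hn h
    have hz : AddCircle.toCircle (∑ i : I, n i • (2 • r i)) = 1 := by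
      have hsum (s : Finset I) : AddCircle.toCircle (∑ i ∈ s, n i • (2 • r i)) =
          ∏ i ∈ s, AddCircle.toCircle (n i • (2 • r i)) := by
        induction s using Finset.induction_on with
        | empty => simp
        | insert a s ha ih => rw [Finset.sum_insert ha, Finset.prod_insert ha,
            AddCircle.toCircle_add, ih]
      rw [hsum]
      refine Circle.coe_injective (?_ : Circle.coeHom _ = Circle.coeHom 1)
      rw [map_prod, map_one]
      simp only [UnitAddTorus.mFourier, ContinuousMap.coe_mk, fourier_apply] at h
      exact h
    rw [← AddCircle.toCircle_zero, (AddCircle.injective_toCircle one_ne_zero).eq_iff] at hz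
    have hz' : ((∑ i : I, n i * (2 * (v (some i) / v none)) : ℝ) : UnitAddCircle) = 0 := by
      rw [← hz, ← QuotientAddGroup.mk'_apply, map_sum]
      refine Finset.sum_congr rfl fun i _ ↦ ?_
      rw [← zsmul_eq_mul, map_zsmul, ← Nat.cast_ofNat, ← nsmul_eq_mul, map_nsmul]
      rfl
    obtain ⟨m, hm⟩ := AddCircle.coe_eq_zero_iff _ |>.1 hz'
    have hli := hv.comp (fun o : Option I ↦ o.map Subtype.val)
      (Option.map_injective Subtype.val_injective)
    have h0 := Fintype.linearIndependent_iff.1 hli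
      (fun o ↦ o.elim (-m) fun i ↦ 2 * n i) (by
        rw [Fintype.sum_option]
        simp only [Option.elim, Function.comp, Option.map, Rat.smul_def]
        push_cast
        have h1 : ∑ i : I, (2 * (n i : ℝ)) * v (some i) =
            (∑ i : I, n i * (2 * (v (some i) / v none))) * v none := by
          rw [Finset.sum_mul]
          refine Finset.sum_congr rfl fun i _ ↦ ?_
          field_simp
        rw [h1, ← hm]
        simp)
    refine hn (funext fun i ↦ ?_)
    simpa using h0 (some i)
  obtain ⟨k, hk⟩ := key.exists_mem_open
    (s := Set.univ.pi fun i : I ↦ u i) (isOpen_set_pi Set.finite_univ fun i _ ↦ (hu i i.2).1)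
    ⟨fun i ↦ f i, fun i _ ↦ (hu i i.2).2⟩
  refine ⟨_, hIU fun i hi ↦ ?_, k, rfl⟩
  have := hk ⟨i, hi⟩ trivial
  simpa only [Pi.smul_apply, smul_smul, mul_comm] using this

theorem exists_denseRange_circle (ι : Type) (hι : Cardinal.mk ι ≤ Cardinal.continuum) :
    ∃ (θ : AddCircle (2 * Real.pi)) (ρ : ι → Circle),
      DenseRange fun k : ℕ ↦ ((2 * k) • θ, ρ ^ (2 * k)) := by
  obtain ⟨r, hr⟩ := exists_denseRange_nsmul (Option ι) (by
    rw [Cardinal.mk_option]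
    exact Cardinal.add_le_of_le Cardinal.aleph0_le_continuum hι
      (Cardinal.one_le_aleph0.trans Cardinal.aleph0_le_continuum))
  have hpi : 2 * Real.pi ≠ 0 := by positivity
  let e := AddCircle.homeomorphAddCircle (1 : ℝ) (2 * Real.pi) one_ne_zero hpi
  let φ : (Option ι → UnitAddCircle) → AddCircle (2 * Real.pi) × (ι → Circle) :=
    fun x ↦ (e (x none), fun i ↦ (x (some i)).toCircle)
  have hφ : Continuous φ := by
    refine (e.continuous.comp (continuous_apply none)).prodMk (continuous_pi fun i ↦ ?_)
    exact AddCircle.continuous_toCircle.comp (continuous_apply (some i))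
  have hs : Function.Surjective φ := by
    rintro ⟨a, b⟩
    refine ⟨fun o ↦ o.elim (e.symm a)
      fun i ↦ (AddCircle.homeomorphCircle one_ne_zero).symm (b i), Prod.ext ?_ ?_⟩
    · exact e.apply_symm_apply a
    · funext i
      change AddCircle.toCircle ((AddCircle.homeomorphCircle one_ne_zero).symm (b i)) = b i
      rw [← AddCircle.homeomorphCircle_apply (one_ne_zero : (1 : ℝ) ≠ 0)]
      exact (AddCircle.homeomorphCircle one_ne_zero).apply_symm_apply (b i)
  refine ⟨(φ r).1, (φ r).2, ?_⟩
  convert hs.denseRange.comp hr hφ using 1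
  funext k
  refine Prod.ext ?_ ?_
  · exact (map_nsmul (AddCircle.equivAddCircle (1 : ℝ) (2 * Real.pi) one_ne_zero hpi) _ _).symm
  · funext i
    exact (AddCircle.toCircle_nsmul _ _).symm

section Shift

variable {𝕂 Y : Type*} [RCLike 𝕂] [TopologicalSpace Y]

/-- Restriction of a function on `Y ⊕ OnePoint ℕ` to `Y`. -/
def ContinuousMap.restrictInl (f : C(Y ⊕ OnePoint ℕ, 𝕂)) : C(Y, 𝕂) :=
  f.comp ⟨Sum.inl, continuous_inl⟩

@[simp]
theorem ContinuousMap.restrictInl_apply (f : C(Y ⊕ OnePoint ℕ, 𝕂)) (y : Y) :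
    f.restrictInl y = f (Sum.inl y) := rfl

theorem ContinuousMap.tendsto_inr_coe (f : C(Y ⊕ OnePoint ℕ, 𝕂)) :
    Tendsto (fun n : ℕ ↦ f (Sum.inr (n : OnePoint ℕ))) atTop (𝓝 (f (Sum.inr OnePoint.infty))) :=
  (OnePoint.continuous_iff_from_nat fun x ↦ f (Sum.inr x)).1
    (f.continuous.comp continuous_inr)

/-- The function `Tf` that equals `-f ∘ h` on `Y`, takes the value `Δ (f|_Y)` at `0`, the value
`f n` at `n + 1`, and the value `f ∞` at `∞`. -/
def shiftFun (h : C(Y, Y)) (Δ : C(Y, 𝕂) → 𝕂) (f : C(Y ⊕ OnePoint ℕ, 𝕂)) :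
    C(Y ⊕ OnePoint ℕ, 𝕂) where
  toFun := Sum.elim (fun y ↦ -f (Sum.inl (h y)))
    (fun x ↦ x.elim (f (Sum.inr OnePoint.infty))
      fun n ↦ Nat.casesOn n (Δ f.restrictInl) fun m ↦ f (Sum.inr (m : OnePoint ℕ)))
  continuous_toFun := by
    refine Continuous.sumElim (by fun_prop) ?_
    rw [OnePoint.continuous_iff_from_nat, ← tendsto_add_atTop_iff_nat 1]
    exact f.tendsto_inr_coe

@[simp]
theorem shiftFun_inl (h : C(Y, Y)) (Δ : C(Y, 𝕂) → 𝕂) (f : C(Y ⊕ OnePoint ℕ, 𝕂)) (y : Y) :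
    shiftFun h Δ f (Sum.inl y) = -f (Sum.inl (h y)) := rfl

@[simp]
theorem shiftFun_infty (h : C(Y, Y)) (Δ : C(Y, 𝕂) → 𝕂) (f : C(Y ⊕ OnePoint ℕ, 𝕂)) :
    shiftFun h Δ f (Sum.inr OnePoint.infty) = f (Sum.inr OnePoint.infty) := rfl

theorem shiftFun_zero (h : C(Y, Y)) (Δ : C(Y, 𝕂) → 𝕂) (f : C(Y ⊕ OnePoint ℕ, 𝕂)) :
    shiftFun h Δ f (Sum.inr ((0 : ℕ) : OnePoint ℕ)) = Δ f.restrictInl := rfl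

theorem shiftFun_succ (h : C(Y, Y)) (Δ : C(Y, 𝕂) → 𝕂) (f : C(Y ⊕ OnePoint ℕ, 𝕂)) (n : ℕ) :
    shiftFun h Δ f (Sum.inr ((n + 1 : ℕ) : OnePoint ℕ)) = f (Sum.inr (n : OnePoint ℕ)) := rfl

theorem iterate_shiftFun_inl (h : Y ≃ₜ Y) (Δ : C(Y, 𝕂) → 𝕂) (n : ℕ)
    (f : C(Y ⊕ OnePoint ℕ, 𝕂)) (y : Y) :
    (shiftFun (h.symm : C(Y, Y)) Δ)^[n] f (Sum.inl (h^[n] y)) = (-1) ^ n * f (Sum.inl y) := by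
  induction n with
  | zero => simp
  | succ n ih =>
    rw [Function.iterate_succ_apply', Function.iterate_succ_apply', shiftFun_inl]
    simp [ih, pow_succ]

theorem iterate_shiftFun_natCast (h : C(Y, Y)) (Δ : C(Y, 𝕂) → 𝕂) (n : ℕ)
    (f : C(Y ⊕ OnePoint ℕ, 𝕂)) :
    (shiftFun h Δ)^[n] f (Sum.inr (n : OnePoint ℕ)) = f (Sum.inr ((0 : ℕ) : OnePoint ℕ)) := by
  induction n with
  | zero => rfl
  | succ n ih => rw [Function.iterate_succ_apply', shiftFun_succ, ih]

variable [CompactSpace Y]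

theorem norm_shiftFun (h : Y ≃ₜ Y) {Δ : C(Y, 𝕂) → 𝕂} (hΔ : ∀ g, ‖Δ g‖ ≤ ‖g‖)
    (f : C(Y ⊕ OnePoint ℕ, 𝕂)) : ‖shiftFun (h.symm : C(Y, Y)) Δ f‖ = ‖f‖ := by
  apply le_antisymm
  · rw [ContinuousMap.norm_le _ (norm_nonneg _)]
    rintro (y | x)
    · simpa using f.norm_coe_le_norm _
    · induction x using OnePoint.rec with
      | infty => exact f.norm_coe_le_norm _
      | coe n =>
        cases n with
        | zero =>
          refine (hΔ _).trans ?_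
          rw [ContinuousMap.norm_le _ (norm_nonneg _)]
          exact fun y ↦ f.norm_coe_le_norm _
        | succ n => exact f.norm_coe_le_norm _
  · rw [ContinuousMap.norm_le _ (norm_nonneg _)]
    rintro (y | x)
    · have := (shiftFun (h.symm : C(Y, Y)) Δ f).norm_coe_le_norm (Sum.inl (h y))
      simpa using this
    · induction x using OnePoint.rec with
      | infty => exact (shiftFun (h.symm : C(Y, Y)) Δ f).norm_coe_le_norm (Sum.inr OnePoint.infty)
      | coe n => exact (shiftFun (h.symm : C(Y, Y)) Δ f).norm_coe_le_norm
                  (Sum.inr ((n + 1 : ℕ) : OnePoint ℕ))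

/-- The operator `shiftFun` as a continuous linear map. -/
noncomputable def shiftCLM (h : Y ≃ₜ Y) (Δ : C(Y, 𝕂) →ₗ[𝕂] 𝕂) (hΔ : ∀ g, ‖Δ g‖ ≤ ‖g‖) :
    C(Y ⊕ OnePoint ℕ, 𝕂) →L[𝕂] C(Y ⊕ OnePoint ℕ, 𝕂) :=
  LinearMap.mkContinuous
    { toFun := shiftFun (h.symm : C(Y, Y)) Δ
      map_add' := fun f g ↦ by
        ext (y | x)
        · simp [add_comm]
        · induction x using OnePoint.rec with
          | infty => rfl
          | coe n =>
            cases n with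
            | zero => exact map_add Δ f.restrictInl g.restrictInl
            | succ n => rfl
      map_smul' := fun c f ↦ by
        ext (y | x)
        · simp
        · induction x using OnePoint.rec with
          | infty => rfl
          | coe n =>
            cases n with
            | zero => exact map_smul Δ c f.restrictInl
            | succ n => rfl }
    1 fun f ↦ by rw [one_mul]; exact (norm_shiftFun h hΔ f).le

theorem coe_shiftCLM (h : Y ≃ₜ Y) (Δ : C(Y, 𝕂) →ₗ[𝕂] 𝕂) (hΔ : ∀ g, ‖Δ g‖ ≤ ‖g‖) :
    ⇑(shiftCLM h Δ hΔ) = shiftFun (h.symm : C(Y, Y)) Δ := rfl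

theorem rank_quotient_range_shiftCLM (h : Y ≃ₜ Y) (Δ : C(Y, 𝕂) →ₗ[𝕂] 𝕂)
    (hΔ : ∀ g, ‖Δ g‖ ≤ ‖g‖) :
    Module.rank 𝕂 (C(Y ⊕ OnePoint ℕ, 𝕂) ⧸ LinearMap.range
      (shiftCLM h Δ hΔ : C(Y ⊕ OnePoint ℕ, 𝕂) →ₗ[𝕂] C(Y ⊕ OnePoint ℕ, 𝕂))) = 1 := by
  let l : C(Y ⊕ OnePoint ℕ, 𝕂) →ₗ[𝕂] 𝕂 :=
    { toFun := fun g ↦ g (Sum.inr ((0 : ℕ) : OnePoint ℕ)) + Δ (g.restrictInl.comp (h : C(Y, Y)))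
      map_add' := fun f g ↦ by
        have : (f + g).restrictInl.comp (h : C(Y, Y)) =
          f.restrictInl.comp (h : C(Y, Y)) + g.restrictInl.comp (h : C(Y, Y)) := rfl
        rw [this, map_add, ContinuousMap.add_apply]; ring
      map_smul' := fun c f ↦ by
        have : (c • f).restrictInl.comp (h : C(Y, Y)) =
          c • f.restrictInl.comp (h : C(Y, Y)) := rfl
        rw [this, map_smul, ContinuousMap.smul_apply, RingHom.id_apply, smul_add] }
  have hl (g) : l g = g (Sum.inr ((0 : ℕ) : OnePoint ℕ)) +
    Δ (g.restrictInl.comp (h : C(Y, Y))) := rfl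
  have hker : LinearMap.range (shiftCLM h Δ hΔ : C(Y ⊕ OnePoint ℕ, 𝕂) →ₗ[𝕂] _) =
      LinearMap.ker l := by
    ext g
    rw [LinearMap.mem_ker, hl]
    constructor
    · rintro ⟨f, rfl⟩
      rw [ContinuousLinearMap.coe_coe, coe_shiftCLM, shiftFun_zero, ← map_add]
      convert map_zero Δ
      ext y
      simp
    · intro hg
      let f : C(Y ⊕ OnePoint ℕ, 𝕂) :=
        { toFun := Sum.elim (fun y ↦ -g (Sum.inl (h y)))
            (fun x ↦ x.elim (g (Sum.inr OnePoint.infty))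
              fun n ↦ g (Sum.inr ((n + 1 : ℕ) : OnePoint ℕ)))
          continuous_toFun := by
            refine Continuous.sumElim (by fun_prop) ?_
            rw [OnePoint.continuous_iff_from_nat]
            exact (tendsto_add_atTop_iff_nat 1).2 g.tendsto_inr_coe }
      refine ⟨f, ?_⟩
      rw [ContinuousLinearMap.coe_coe, coe_shiftCLM]
      ext (y | x)
      · simp [f]
      · induction x using OnePoint.rec with
        | infty => rfl
        | coe n =>
          cases n with
          | zero =>
            rw [shiftFun_zero, eq_neg_of_add_eq_zero_left hg, ← map_neg]
            rfl
          | succ n => rfl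
  have hsurj : Function.Surjective l := by
    intro c
    let f : C(Y ⊕ OnePoint ℕ, 𝕂) :=
      { toFun := Sum.elim (fun _ ↦ 0) fun _ ↦ c
        continuous_toFun := by fun_prop }
    refine ⟨f, ?_⟩
    have : f.restrictInl.comp (h : C(Y, Y)) = 0 := rfl
    rw [hl, this, map_zero, add_zero]
    rfl
  have hrank := (l.quotKerEquivOfSurjective hsurj).lift_rank_eq
  rw [Module.rank_self, Cardinal.lift_one, Cardinal.lift_eq_one] at hrank
  rw [hker, hrank]

theorem iInter_range_iterate_shiftCLM (h : Y ≃ₜ Y) (Δ : C(Y, 𝕂) →ₗ[𝕂] 𝕂)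
    (hΔ : ∀ g, ‖Δ g‖ ≤ ‖g‖)
    (hinj : ∀ (f : C(Y, 𝕂)) (c : 𝕂), Tendsto (fun k : ℕ ↦ (-1) ^ k *
      Δ (f.comp ⟨h^[k], h.continuous.iterate k⟩)) atTop (𝓝 c) → f = 0) :
    (⋂ n : ℕ, Set.range (⇑(shiftCLM h Δ hΔ))^[n + 1]) = {0} := by
  refine Set.eq_singleton_iff_unique_mem.2 ⟨Set.mem_iInter.2 fun n ↦ ⟨0, ?_⟩, fun f hf ↦ ?_⟩
  · exact Function.iterate_fixed (map_zero _) _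
  have hval (n : ℕ) : f (Sum.inr (n : OnePoint ℕ)) =
      (-1) ^ (n + 1) * Δ (f.restrictInl.comp ⟨h^[n + 1], h.continuous.iterate (n + 1)⟩) := by
    obtain ⟨g, rfl⟩ := Set.mem_iInter.1 hf n
    rw [coe_shiftCLM]
    have h1 : ((shiftFun (h.symm : C(Y, Y)) Δ)^[n + 1] g).restrictInl.comp
        ⟨h^[n + 1], h.continuous.iterate (n + 1)⟩ = (-1 : 𝕂) ^ (n + 1) • g.restrictInl := by
      ext y
      exact iterate_shiftFun_inl h Δ (n + 1) g y
    rw [h1, map_smul, smul_eq_mul, ← mul_assoc, ← mul_pow, neg_one_mul, neg_neg, one_pow, one_mul,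
      Function.iterate_succ_apply, iterate_shiftFun_natCast, shiftFun_zero]
  have hlim := f.tendsto_inr_coe
  simp only [hval] at hlim
  have h0 := hinj _ _ ((tendsto_add_atTop_iff_nat 1).1 hlim)
  have hn (n : ℕ) : f (Sum.inr (n : OnePoint ℕ)) = 0 := by
    rw [hval, h0, ContinuousMap.zero_comp, map_zero, mul_zero]
  ext (y | x)
  · exact congrArg (fun g : C(Y, 𝕂) ↦ g y) h0
  · induction x using OnePoint.rec with
    | infty =>
      have := f.tendsto_inr_coe
      simp only [hn] at this
      exact tendsto_nhds_unique this tendsto_const_nhds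
    | coe n => exact hn n

/-- A homeomorphism of `Y` together with a functional on `C(Y)` whose signed orbits determine
functions yields an isometric shift on `C(Y ⊕ OnePoint ℕ)`. -/
theorem exists_isIsometricShift (h : Y ≃ₜ Y) (Δ : C(Y, 𝕂) →L[𝕂] 𝕂)
    (hinj : ∀ (f : C(Y, 𝕂)) (c : 𝕂), Tendsto (fun k : ℕ ↦ (-1) ^ k *
      Δ (f.comp ⟨h^[k], h.continuous.iterate k⟩)) atTop (𝓝 c) → f = 0) :
    ∃ T : C(Y ⊕ OnePoint ℕ, 𝕂) →L[𝕂] C(Y ⊕ OnePoint ℕ, 𝕂), IsIsometricShift T := by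
  let a : ℝ := (‖Δ‖ + 1)⁻¹
  have ha : 0 < a := by positivity
  let D : C(Y, 𝕂) →ₗ[𝕂] 𝕂 := (a : 𝕂) • (Δ : C(Y, 𝕂) →ₗ[𝕂] 𝕂)
  have hD : ∀ g, ‖D g‖ ≤ ‖g‖ := by
    intro g
    change ‖(a : 𝕂) * Δ g‖ ≤ ‖g‖
    rw [norm_mul, RCLike.norm_ofReal, abs_of_pos ha, inv_mul_le_iff₀ (by positivity)]
    refine (Δ.le_opNorm g).trans ?_
    gcongr
    linarith
  refine ⟨shiftCLM h D hD, norm_shiftFun h hD, rank_quotient_range_shiftCLM h D hD,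
    iInter_range_iterate_shiftCLM h D hD fun f c hc ↦ hinj f ((a : 𝕂)⁻¹ * c) ?_⟩
  refine (hc.const_mul (a : 𝕂)⁻¹).congr fun k ↦ ?_
  have ha' : (a : 𝕂) ≠ 0 := by exact_mod_cast ha.ne'
  change (a : 𝕂)⁻¹ * ((-1) ^ k * ((a : 𝕂) * Δ _)) = _
  field_simp

end Shift

theorem eq_zero_of_tendsto_neg_one_pow_mul {X : Type*} [TopologicalSpace X] (τ : X ≃ₜ X) (x₀ : X)
    (hd : DenseRange fun k : ℕ ↦ τ^[2 * k] x₀) {G : X → ℝ} (hG : Continuous G) {c : ℝ}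
    (hc : Tendsto (fun k : ℕ ↦ (-1) ^ k * G (τ^[k] x₀)) atTop (𝓝 c)) (y : X) : G y = 0 := by
  have hdense (N : ℕ) : DenseRange fun k : ℕ ↦ τ^[2 * k + N] x₀ := by
    induction N with
    | zero => exact hd
    | succ N ih =>
      convert τ.surjective.denseRange.comp ih τ.continuous using 1
      funext k
      exact Function.iterate_succ_apply' _ _ _
  have key (a c' : ℝ) (j : ℕ) (hj : Tendsto (fun k : ℕ ↦ a * G (τ^[2 * k + j] x₀)) atTop (𝓝 c')) :
      a * G y = c' := by
    refine eq_of_forall_dist_le fun ε hε ↦ ?_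
    obtain ⟨N, hN⟩ := eventually_atTop.1 (hj.eventually (Metric.closedBall_mem_nhds c' hε))
    refine isClosed_property (hdense (2 * N + j))
      (isClosed_le (by fun_prop) continuous_const :
        IsClosed {x | dist (a * G x) c' ≤ ε}) (fun k ↦ ?_) y
    have := hN (k + N) (by omega)
    rwa [show 2 * (k + N) + j = 2 * k + (2 * N + j) by ring] at this
  have h1 := key 1 c 0 ((hc.comp (tendsto_id.const_mul_atTop' (r := 2) two_pos)).congr
    fun k ↦ by simp [pow_mul])
  have h2 := key (-1) c 1 ((hc.comp (tendsto_atTop_mono (fun k ↦ by simp only [id]; omega)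
    tendsto_id : Tendsto (fun k : ℕ ↦ 2 * k + 1) atTop atTop)).congr
    fun k ↦ by simp [pow_mul, pow_succ])
  linarith

section

variable {M : Type*} [TopologicalSpace M] [CompactSpace M] [T2Space M]

theorem ContinuousMap.ext_point {x y : M} (h : ∀ f : C(M, ℂ), f x = f y) : x = y :=
  (WeakDual.CharacterSpace.continuousMapEval_bijective (X := M) (𝕜 := ℂ)).1
    (WeakDual.CharacterSpace.ext h)

theorem ContinuousMap.exists_comp_of_algHom (α : C(M, ℂ) →ₐ[ℂ] C(M, ℂ)) :
    ∃ h : C(M, M), ∀ f, α f = f.comp h := by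
  let χ (x : M) : WeakDual.characterSpace ℂ C(M, ℂ) :=
    WeakDual.CharacterSpace.equivAlgHom.symm ((ContinuousMap.evalAlgHom ℂ ℂ x).comp α)
  have hχ (x : M) (f : C(M, ℂ)) : χ x f = α f x := rfl
  have hcont : Continuous χ := by
    refine Continuous.subtype_mk (WeakDual.continuous_of_continuous_eval fun f ↦ ?_) _
    exact (α f).continuous
  let E := WeakDual.CharacterSpace.homeoEval M ℂ
  refine ⟨⟨fun x ↦ E.symm (χ x), E.symm.continuous.comp hcont⟩, fun f ↦ ?_⟩
  ext x
  have := congrArg (fun φ : WeakDual.characterSpace ℂ C(M, ℂ) ↦ φ f) (E.apply_symm_apply (χ x))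
  exact this.symm

end

open MeasureTheory AddCircle
open scoped ComplexConjugate

section

variable {T : ℝ} [hT : Fact (0 < T)]

theorem MeasureTheory.Lp.ae_norm_le_norm {α : Type*} [MeasurableSpace α] {μ : Measure α}
    (φ : Lp ℂ ⊤ μ) : ∀ᵐ x ∂μ, ‖φ x‖ ≤ ‖φ‖ := by
  filter_upwards [ae_le_eLpNormEssSup (f := φ) (μ := μ)] with x hx
  rw [Lp.norm_def, eLpNorm_exponent_top, ← toReal_enorm]
  refine ENNReal.toReal_mono ?_ hx
  rw [← eLpNorm_exponent_top]
  exact Lp.eLpNorm_ne_top φ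

/-- The pairing `(φ, v) ↦ ∫ φ v` between `L^∞` and continuous functions on the circle. -/
noncomputable def circlePairing (T : ℝ) [hT : Fact (0 < T)] :
    Lp ℂ ⊤ (volume : Measure (AddCircle T)) →L[ℂ] C(AddCircle T, ℂ) →L[ℂ] ℂ :=
  have hinteg (φ : Lp ℂ ⊤ (volume : Measure (AddCircle T))) (v : C(AddCircle T, ℂ)) :
      Integrable (fun x ↦ φ x * v x) :=
    ((Lp.memLp φ).integrable le_top).mul_bdd (c := ‖v‖) v.continuous.aestronglyMeasurable
      (ae_of_all _ v.norm_coe_le_norm)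
  LinearMap.mkContinuous₂
    (LinearMap.mk₂ ℂ (fun φ v ↦ ∫ x, φ x * v x)
      (fun φ ψ v ↦ by
        rw [← integral_add (hinteg φ v) (hinteg ψ v)]
        refine integral_congr_ae ?_
        filter_upwards [Lp.coeFn_add φ ψ] with x hx
        rw [hx, Pi.add_apply, add_mul])
      (fun c φ v ↦ by
        rw [smul_eq_mul, ← integral_const_mul]
        refine integral_congr_ae ?_
        filter_upwards [Lp.coeFn_smul c φ] with x hx
        rw [hx, Pi.smul_apply, smul_eq_mul, mul_assoc])
      (fun φ v w ↦ by
        rw [← integral_add (hinteg φ v) (hinteg φ w)]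
        simp only [ContinuousMap.add_apply, mul_add])
      (fun c φ v ↦ by
        rw [smul_eq_mul, ← integral_const_mul]
        simp only [ContinuousMap.smul_apply, smul_eq_mul, mul_left_comm]))
    ((volume : Measure (AddCircle T)).real Set.univ) fun φ v ↦ by
      rw [LinearMap.mk₂_apply]
      refine (norm_integral_le_of_norm_le_const (C := ‖φ‖ * ‖v‖) ?_).trans_eq (by ring)
      filter_upwards [Lp.ae_norm_le_norm φ] with x hx
      rw [norm_mul]
      exact mul_le_mul hx (v.norm_coe_le_norm x) (norm_nonneg _) (norm_nonneg _)

theorem circlePairing_apply (φ : Lp ℂ ⊤ (volume : Measure (AddCircle T)))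
    (v : C(AddCircle T, ℂ)) : circlePairing T φ v = ∫ x, φ x * v x := rfl

theorem eq_zero_of_circlePairing_fourier {φ : Lp ℂ ⊤ (volume : Measure (AddCircle T))}
    (h : ∀ n, circlePairing T φ (fourier n) = 0) : φ = 0 := by
  have hmem : MemLp φ 2 (haarAddCircle (T := T)) :=
    memLp_haarAddCircle_iff.2 ((Lp.memLp φ).mono_exponent le_top)
  have hcoeff (n : ℤ) : fourierCoeff (hmem.toLp φ) n = 0 := by
    rw [fourierCoeff_congr_ae hmem.coeFn_toLp, fourierCoeff, integral_haarAddCircle]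
    have := h (-n)
    rw [circlePairing_apply] at this
    simp only [smul_eq_mul, mul_comm _ (φ _)]
    rw [this, smul_zero]
  have hsum := hasSum_fourier_series_L2 (hmem.toLp φ)
  simp only [hcoeff, zero_smul] at hsum
  have h0 := hsum.unique hasSum_zero
  have hae : ⇑φ =ᵐ[haarAddCircle] 0 := hmem.coeFn_toLp.symm.trans (by
    rw [h0]; exact Lp.coeFn_zero _ _ _)
  have hvol : ⇑φ =ᵐ[volume] 0 := Measure.ae_smul_measure hae (ENNReal.ofReal T)
  exact Lp.ext (hvol.trans (Lp.coeFn_zero ℂ ⊤ _).symm)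

/-- The translate by `s` of the Poisson-type kernel `∑ 2^{-|n|} eₙ`. -/
noncomputable def poissonTranslate (s : AddCircle T) : C(AddCircle T, ℂ) :=
  ∑' n : ℤ, ((1 / 2 : ℂ) ^ n.natAbs * fourier (-n) s) • fourier n

theorem summable_half_pow_natAbs : Summable fun n : ℤ ↦ (1 / 2 : ℝ) ^ n.natAbs := by
  apply Summable.of_nat_of_neg <;> simpa using summable_geometric_two

theorem norm_poissonTranslate_term (s : AddCircle T) (n : ℤ) :
    ‖((1 / 2 : ℂ) ^ n.natAbs * fourier (-n) s) • (fourier n : C(AddCircle T, ℂ))‖ ≤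
      (1 / 2 : ℝ) ^ n.natAbs := by
  rw [norm_smul, fourier_norm, mul_one, norm_mul, norm_pow, fourier_apply, Circle.norm_coe]
  simp

theorem hasSum_poissonTranslate (s : AddCircle T) :
    HasSum (fun n : ℤ ↦ ((1 / 2 : ℂ) ^ n.natAbs * fourier (-n) s) •
      (fourier n : C(AddCircle T, ℂ))) (poissonTranslate s) :=
  (Summable.of_norm_bounded summable_half_pow_natAbs (norm_poissonTranslate_term s)).hasSum

theorem continuous_poissonTranslate : Continuous (poissonTranslate (T := T)) :=
  continuous_tsum (fun n ↦ by fun_prop) summable_half_pow_natAbs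
    fun n s ↦ norm_poissonTranslate_term s n

theorem hasSum_poissonTranslate_apply (s x : AddCircle T) :
    HasSum (fun n : ℤ ↦ (1 / 2 : ℂ) ^ n.natAbs * fourier (-n) s * fourier n x)
      (poissonTranslate s x) :=
  (ContinuousMap.evalCLM ℂ x).hasSum (hasSum_poissonTranslate s)

theorem poissonTranslate_sub (s x : AddCircle T) :
    poissonTranslate 0 (x - s) = poissonTranslate s x := by
  refine (hasSum_poissonTranslate_apply 0 (x - s)).unique ?_
  convert hasSum_poissonTranslate_apply s x using 2 with n
  have : fourier n (x - s) = fourier n x * fourier (-n) s := by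
    rw [fourier_apply, fourier_apply, fourier_apply, smul_sub, sub_eq_add_neg, toCircle_add,
      neg_smul, Circle.coe_mul]
  rw [this, fourier_eval_zero]
  ring

theorem conj_poissonTranslate (s x : AddCircle T) :
    conj (poissonTranslate s x) = poissonTranslate s x := by
  have h := (hasSum_poissonTranslate_apply s x).map (starRingEnd ℂ) Complex.continuous_conj
  refine h.unique ?_
  refine ((Equiv.neg ℤ).hasSum_iff.2 (hasSum_poissonTranslate_apply s x)).congr_fun ?_
  intro n
  simp [map_ofNat]

theorem eq_zero_of_circlePairing_poissonTranslate
    {φ : Lp ℂ ⊤ (volume : Measure (AddCircle T))}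
    (h : ∀ s, circlePairing T φ (poissonTranslate s) = 0) : φ = 0 := by
  refine eq_zero_of_circlePairing_fourier fun m ↦ ?_
  set a : ℤ → ℂ := fun n ↦ (1 / 2 : ℂ) ^ n.natAbs * circlePairing T φ (fourier n)
  have hsummable : Summable fun n : ℤ ↦ a n • (fourier (-n) : C(AddCircle T, ℂ)) := by
    refine Summable.of_norm_bounded (summable_half_pow_natAbs.mul_right ‖circlePairing T φ‖)
      fun n ↦ ?_
    rw [norm_smul, fourier_norm, mul_one, norm_mul, norm_pow]
    have := (circlePairing T φ).le_opNorm (fourier n)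
    rw [fourier_norm, mul_one] at this
    simp only [one_div, norm_inv, Complex.norm_ofNat]
    gcongr
  have hzero : ∑' n : ℤ, a n • (fourier (-n) : C(AddCircle T, ℂ)) = 0 := by
    ext s
    have h1 := (ContinuousMap.evalCLM ℂ s).hasSum hsummable.hasSum
    have h2 := (circlePairing T φ).hasSum (hasSum_poissonTranslate s)
    rw [h s] at h2
    refine h1.unique (h2.congr_fun fun n ↦ ?_)
    simp only [map_smul, smul_eq_mul, a]
    change _ * fourier (-n) s = _
    ring
  have hs := hsummable.hasSum
  rw [hzero] at hs
  let ψ := circlePairing T (ContinuousMap.toLp ⊤ volume ℂ (fourier m))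
  have hψ (n : ℤ) : ψ (fourier (-n)) = T * fourierCoeff (fourier (T := T) m) n := by
    rw [fourierCoeff, integral_haarAddCircle, circlePairing_apply, Complex.real_smul,
      Complex.ofReal_inv, mul_inv_cancel_left₀ (by exact_mod_cast hT.out.ne')]
    refine integral_congr_ae ?_
    filter_upwards [ContinuousMap.coeFn_toLp (p := ⊤) (𝕜 := ℂ) (volume : Measure (AddCircle T))
      (fourier m)] with x hx
    rw [hx, smul_eq_mul, mul_comm]
  have hψs := ψ.hasSum hs
  simp only [map_smul, hψ, fourierCoeff_fourier, map_zero] at hψs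
  have h0 := hψs.unique (hasSum_single m fun n hn ↦ by simp [Pi.single_eq_of_ne hn])
  simpa [a, hT.out.ne'] using h0.symm

end

section

variable {M : Type*} [TopologicalSpace M] [CompactSpace M]

theorem coeFn_map_mul {α : Type*} [MeasurableSpace α] {μ : Measure α}
    {e : C(M, ℂ) ≃ₗᵢ[ℂ] Lp ℂ ⊤ μ}
    (he : ∀ f g, (e (f * g) : α →ₘ[μ] ℂ) = ↑(e f) * ↑(e g)) (f g : C(M, ℂ)) :
    ⇑(e (f * g)) =ᵐ[μ] fun x ↦ e f x * e g x := by
  have := AEEqFun.coeFn_mul (e f : α →ₘ[μ] ℂ) (e g)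
  rw [← he] at this
  exact this

theorem coeFn_map_one {α : Type*} [MeasurableSpace α] {μ : Measure α} [IsFiniteMeasure μ]
    {e : C(M, ℂ) ≃ₗᵢ[ℂ] Lp ℂ ⊤ μ}
    (he : ∀ f g, (e (f * g) : α →ₘ[μ] ℂ) = ↑(e f) * ↑(e g)) :
    ⇑(e 1) =ᵐ[μ] fun _ ↦ 1 := by
  have h := coeFn_map_mul he 1 (e.symm (Lp.const ⊤ μ 1))
  rw [one_mul, e.apply_symm_apply] at h
  filter_upwards [h, Lp.coeFn_const (μ := μ) (p := ⊤) (1 : ℂ)] with x h1 h2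
  rw [h2] at h1
  simpa using h1.symm

theorem ae_im_eq_zero {α : Type*} [MeasurableSpace α] {μ : Measure α} [IsFiniteMeasure μ]
    {e : C(M, ℂ) ≃ₗᵢ[ℂ] Lp ℂ ⊤ μ}
    (he : ∀ f g, (e (f * g) : α →ₘ[μ] ℂ) = ↑(e f) * ↑(e g)) {f : C(M, ℂ)}
    (hf : ∀ m, (f m).im = 0) : ∀ᵐ x ∂μ, (e f x).im = 0 := by
  have h (t : ℤ) : ∀ᵐ x ∂μ, ‖e f x + t * Complex.I‖ ^ 2 ≤ ‖f‖ ^ 2 + t ^ 2 := by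
    have hadd := Lp.coeFn_add (e f) (((t : ℂ) * Complex.I) • e 1)
    filter_upwards [hadd, Lp.coeFn_smul ((t : ℂ) * Complex.I) (e 1), coeFn_map_one he,
      Lp.ae_norm_le_norm (e f + ((t : ℂ) * Complex.I) • e 1)] with x h1 h2 h3 h4
    rw [h1, Pi.add_apply, h2, Pi.smul_apply, h3, smul_eq_mul, mul_one, ← map_smul, ← map_add,
      e.norm_map] at h4
    have hn : ‖f + ((t : ℂ) * Complex.I) • (1 : C(M, ℂ))‖ ≤ √(‖f‖ ^ 2 + t ^ 2) := by
      refine (ContinuousMap.norm_le _ (Real.sqrt_nonneg _)).2 fun m ↦ Real.le_sqrt_of_sq_le ?_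
      have hm := f.norm_coe_le_norm m
      have hsq : ‖f m‖ ^ 2 ≤ ‖f‖ ^ 2 := by gcongr
      rw [← Complex.normSq_eq_norm_sq, Complex.normSq_apply] at hsq ⊢
      simp [hf m] at hsq ⊢
      nlinarith
    calc _ ≤ √(‖f‖ ^ 2 + t ^ 2) ^ 2 := by gcongr; exact h4.trans hn
      _ = _ := Real.sq_sqrt (by positivity)
  filter_upwards [ae_all_iff.2 h] with x hx
  have hlin (t : ℤ) : 2 * (e f x).im * t ≤ ‖f‖ ^ 2 := by
    have := hx t
    rw [← Complex.normSq_eq_norm_sq, Complex.normSq_apply] at this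
    simp at this
    nlinarith [sq_nonneg (e f x).re, sq_nonneg (e f x).im]
  by_contra hne
  rcases lt_or_gt_of_ne hne with hneg | hpos
  · obtain ⟨n, hn⟩ := exists_nat_gt (‖f‖ ^ 2 / (-(2 * (e f x).im)))
    rw [div_lt_iff₀ (by linarith)] at hn
    have := hlin (-n)
    push_cast at this
    linarith
  · obtain ⟨n, hn⟩ := exists_nat_gt (‖f‖ ^ 2 / (2 * (e f x).im))
    rw [div_lt_iff₀ (by linarith)] at hn
    have := hlin n
    push_cast at this
    linarith

variable [T2Space M] {G : Type*} [AddCommGroup G] [MeasurableSpace G] [MeasurableAdd G]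
  {μ : Measure G} [IsFiniteMeasure μ] [μ.IsAddRightInvariant]

theorem exists_continuousMap_translate
    {e : C(M, ℂ) ≃ₗᵢ[ℂ] Lp ℂ ⊤ μ}
    (he : ∀ f g, (e (f * g) : G →ₘ[μ] ℂ) = ↑(e f) * ↑(e g)) (θ : G) :
    ∃ h : C(M, M), ∀ f, ⇑(e (f.comp h)) =ᵐ[μ] fun x ↦ e f (x + θ) := by
  have hp := measurePreserving_add_right μ θ
  let R := Lp.compMeasurePreservingₗᵢ ℂ (E := ℂ) (p := ⊤) (· + θ) hp
  have hR (φ : Lp ℂ ⊤ μ) : ⇑(R φ) =ᵐ[μ] fun x ↦ φ (x + θ) := Lp.coeFn_compMeasurePreserving φ hp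
  let α : C(M, ℂ) →ₐ[ℂ] C(M, ℂ) :=
    AlgHom.ofLinearMap
      (e.symm.toLinearEquiv.toLinearMap ∘ₗ R.toLinearMap ∘ₗ e.toLinearEquiv.toLinearMap)
      (e.injective <| Lp.ext <| by
        change ⇑(e (e.symm (R (e 1)))) =ᵐ[μ] _
        rw [e.apply_symm_apply]
        filter_upwards [hR (e 1), coeFn_map_one he,
          hp.quasiMeasurePreserving.ae (coeFn_map_one he)] with x h1 h2 h3
        rw [h1, h2, h3])
      (fun f g ↦ e.injective <| Lp.ext <| by
        change ⇑(e (e.symm (R (e (f * g))))) =ᵐ[μ] ⇑(e (e.symm (R (e f)) * e.symm (R (e g))))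
        have h0 := coeFn_map_mul he (e.symm (R (e f))) (e.symm (R (e g)))
        rw [e.apply_symm_apply, e.apply_symm_apply] at h0
        rw [e.apply_symm_apply]
        filter_upwards [hR (e (f * g)), h0, hR (e f), hR (e g),
          hp.quasiMeasurePreserving.ae (coeFn_map_mul he f g)] with x h1 h2 h3 h4 h5
        rw [h1, h2, h3, h4, h5])
  obtain ⟨h, hh⟩ := ContinuousMap.exists_comp_of_algHom α
  refine ⟨h, fun f ↦ ?_⟩
  rw [← hh f]
  change ⇑(e (e.symm (R (e f)))) =ᵐ[μ] _
  rw [e.apply_symm_apply]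
  exact hR _

theorem exists_homeomorph_translate
    {e : C(M, ℂ) ≃ₗᵢ[ℂ] Lp ℂ ⊤ μ}
    (he : ∀ f g, (e (f * g) : G →ₘ[μ] ℂ) = ↑(e f) * ↑(e g)) (θ : G) :
    ∃ h : M ≃ₜ M, ∀ (f : C(M, ℂ)) (k : ℕ),
      ⇑(e (f.comp ⟨h^[k], h.continuous.iterate k⟩)) =ᵐ[μ] fun x ↦ e f (x + k • θ) := by
  choose h hh using exists_continuousMap_translate he
  have hinv (θ : G) (x : M) : h (-θ) (h θ x) = x := by
    refine ContinuousMap.ext_point fun f ↦ ?_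
    have : (f.comp (h (-θ))).comp (h θ) = f := by
      refine e.injective (Lp.ext ?_)
      filter_upwards [hh θ (f.comp (h (-θ))),
        (measurePreserving_add_right μ θ).quasiMeasurePreserving.ae (hh (-θ) f)] with x h1 h2
      rw [h1, h2, add_neg_cancel_right]
    exact congrArg (fun f : C(M, ℂ) ↦ f x) this
  refine ⟨⟨⟨h θ, h (-θ), hinv θ, fun x ↦ by simpa using hinv (-θ) x⟩, (h θ).continuous,
    (h (-θ)).continuous⟩, fun f k ↦ ?_⟩
  induction k with
  | zero => exact .of_eq (by simp; rfl)
  | succ k ih =>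
    filter_upwards [hh θ (f.comp ⟨(h θ)^[k], (h θ).continuous.iterate k⟩),
      (measurePreserving_add_right μ θ).quasiMeasurePreserving.ae ih] with x h1 h2
    refine Eq.trans ?_ (h1.trans (h2.trans ?_))
    · rfl
    · rw [add_assoc, succ_nsmul']

end

section

variable {𝕂 M P : Type*} [RCLike 𝕂] [TopologicalSpace M] [TopologicalSpace P]

/-- The real part of a slice of a function on a product, as a complex-valued function. -/
noncomputable def sliceRe (𝕂 M : Type*) {P : Type*} [RCLike 𝕂] [TopologicalSpace M]
    [TopologicalSpace P] (t : P) : C(M × P, 𝕂) →L[ℝ] C(M, ℂ) where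
  toFun f := ⟨fun m ↦ (RCLike.re (f (m, t)) : ℝ), by fun_prop⟩
  map_add' f g := by ext; simp
  map_smul' c f := by ext; simp [RCLike.smul_re]
  cont := (ContinuousMap.continuous_postcomp (⟨fun z : 𝕂 ↦ ((RCLike.re z : ℝ) : ℂ),
    by fun_prop⟩ : C(𝕂, ℂ))).comp
      (ContinuousMap.continuous_precomp (⟨fun m ↦ (m, t), by fun_prop⟩ : C(M, M × P)))

@[simp]
theorem sliceRe_apply (t : P) (f : C(M × P, 𝕂)) (m : M) :
    sliceRe 𝕂 M t f m = (RCLike.re (f (m, t)) : ℝ) := rfl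

theorem continuous_sliceRe (f : C(M × P, 𝕂)) : Continuous fun t ↦ sliceRe 𝕂 M t f :=
  ContinuousMap.continuous_of_continuous_uncurry _ <| by
    change Continuous fun p : P × M ↦ ((RCLike.re (f (p.2, p.1)) : ℝ) : ℂ)
    fun_prop

variable [CompactSpace M] {T : ℝ} [Fact (0 < T)]

theorem circlePairing_im_eq_zero {φ : Lp ℂ ⊤ (volume : Measure (AddCircle T))}
    (hφ : ∀ᵐ x, (φ x).im = 0) (s : AddCircle T) :
    (circlePairing T φ (poissonTranslate s)).im = 0 := by
  rw [← Complex.conj_eq_iff_im, circlePairing_apply, ← integral_conj]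
  refine integral_congr_ae ?_
  filter_upwards [hφ] with x hx
  rw [map_mul, conj_poissonTranslate, Complex.conj_eq_iff_im.2 hx]

theorem circlePairing_translate {φ ψ : Lp ℂ ⊤ (volume : Measure (AddCircle T))}
    {s : AddCircle T} (h : ⇑ψ =ᵐ[volume] fun x ↦ φ (x + s)) :
    circlePairing T ψ (poissonTranslate 0) = circlePairing T φ (poissonTranslate s) := by
  rw [circlePairing_apply, circlePairing_apply,
    ← integral_add_right_eq_self (fun x ↦ φ x * poissonTranslate s x) s]
  refine integral_congr_ae ?_
  filter_upwards [h] with x hx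
  rw [hx, ← poissonTranslate_sub s, add_sub_cancel_right]

theorem exists_isIsometricShift_prod [T2Space M] [CompactSpace P] [Group P]
    [IsTopologicalGroup P] {e : C(M, ℂ) ≃ₗᵢ[ℂ] Lp ℂ ⊤ (volume : Measure (AddCircle T))}
    (he : ∀ f g, (e (f * g) : AddCircle T →ₘ[volume] ℂ) = ↑(e f) * ↑(e g))
    (θ : AddCircle T) (ρ : P) (hd : DenseRange fun k : ℕ ↦ ((2 * k) • θ, ρ ^ (2 * k))) :
    ∃ S : C((M × P) ⊕ OnePoint ℕ, 𝕂) →L[𝕂] C((M × P) ⊕ OnePoint ℕ, 𝕂),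
      IsIsometricShift S := by
  obtain ⟨h, hh⟩ := exists_homeomorph_translate he θ
  let F : StrongDual ℝ C(M × P, 𝕂) :=
    Complex.reCLM ∘L (((circlePairing T).flip (poissonTranslate 0)).restrictScalars ℝ) ∘L
      ((e.toContinuousLinearEquiv : C(M, ℂ) →L[ℂ] _).restrictScalars ℝ) ∘L sliceRe 𝕂 M 1
  let H : M × P ≃ₜ M × P := h.prodCongr (Homeomorph.mulRight ρ)
  have hH (k : ℕ) (m : M) (t : P) : H^[k] (m, t) = (h^[k] m, t * ρ ^ k) := by
    induction k with
    | zero => simp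
    | succ k ih =>
      rw [Function.iterate_succ_apply', ih, Function.iterate_succ_apply', pow_succ, ← mul_assoc]
      rfl
  let τ : AddCircle T × P ≃ₜ AddCircle T × P :=
    (Homeomorph.addRight θ).prodCongr (Homeomorph.mulRight ρ)
  have hτ (k : ℕ) : τ^[k] (0, 1) = (k • θ, ρ ^ k) := by
    induction k with
    | zero => simp
    | succ k ih => rw [Function.iterate_succ_apply', ih, succ_nsmul, pow_succ]; rfl
  let G (f : C(M × P, 𝕂)) (p : AddCircle T × P) : ℂ :=
    circlePairing T (e (sliceRe 𝕂 M p.2 f)) (poissonTranslate p.1)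
  have hG (f : C(M × P, 𝕂)) : Continuous (G f) :=
    ((circlePairing T).continuous.comp (e.continuous.comp
      ((continuous_sliceRe f).comp continuous_snd))).clm_apply
      (continuous_poissonTranslate.comp continuous_fst)
  have hF (f : C(M × P, 𝕂)) (k : ℕ) :
      F (f.comp ⟨H^[k], H.continuous.iterate k⟩) = (G f (τ^[k] (0, 1))).re := by
    rw [hτ]
    refine congrArg Complex.re (circlePairing_translate ?_)
    have : sliceRe 𝕂 M 1 (f.comp ⟨H^[k], H.continuous.iterate k⟩) =
        (sliceRe 𝕂 M (ρ ^ k) f).comp ⟨h^[k], h.continuous.iterate k⟩ := by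
      ext m
      simp [hH]
    change ⇑(e (sliceRe 𝕂 M 1 _)) =ᵐ[volume] _
    rw [this]
    exact hh _ k
  have key (f : C(M × P, 𝕂)) (c : ℝ) (hc : Tendsto (fun k : ℕ ↦ (-1) ^ k *
      F (f.comp ⟨H^[k], H.continuous.iterate k⟩)) atTop (𝓝 c)) (y : M × P) :
      RCLike.re (f y) = 0 := by
    simp only [hF] at hc
    have hre := eq_zero_of_tendsto_neg_one_pow_mul τ (0, 1) (by simpa only [hτ] using hd)
      (Complex.continuous_re.comp (hG f)) hc
    have hslice : e (sliceRe 𝕂 M y.2 f) = 0 :=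
      eq_zero_of_circlePairing_poissonTranslate fun s ↦ Complex.ext (hre (s, y.2))
        (circlePairing_im_eq_zero (ae_im_eq_zero he fun m ↦ Complex.ofReal_im _) s)
    rw [e.map_eq_zero_iff] at hslice
    exact Complex.ofReal_eq_zero.1 (congrArg (fun g : C(M, ℂ) ↦ g y.1) hslice)
  refine exists_isIsometricShift H F.extendRCLike fun f c hc ↦ ?_
  ext y
  have h0 := key (conj (f y) • f) (RCLike.re (conj (f y) * c)) ?_ y
  · rw [ContinuousMap.smul_apply, smul_eq_mul, RCLike.conj_mul, ← RCLike.ofReal_pow,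
      RCLike.ofReal_re] at h0
    simpa using h0
  · refine ((RCLike.continuous_re.tendsto _).comp (hc.const_mul (conj (f y)))).congr fun k ↦ ?_
    have hs := StrongDual.re_extendRCLike_apply (𝕜 := 𝕂) F
      ((conj (f y) • f).comp ⟨H^[k], H.continuous.iterate k⟩)
    rw [← hs, ContinuousMap.smul_comp, map_smul, Function.comp_apply, smul_eq_mul, mul_left_comm,
      ← RCLike.re_ofReal_mul, RCLike.ofReal_pow, RCLike.ofReal_neg, RCLike.ofReal_one]

end

end

/-- If `C(M;ℂ) ≅ L^∞(𝕋)` isometrically as complex Banach algebras and `ι` is a nonempty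
type of cardinality at most `𝔠`, then `C((M × 𝕋^ι) ⊕ OnePoint ℕ; 𝕂)` admits an isometric
shift. -/
theorem stmt1 (𝕂 : Type) [RCLike 𝕂] (M : Type) [TopologicalSpace M] [CompactSpace M]
    [T2Space M] (hM : IsCMIsoLinftyCircle M) (ι : Type) [Nonempty ι]
    (hι : Cardinal.mk ι ≤ Cardinal.continuum) :
    ∃ T : C((M × (ι → Circle)) ⊕ OnePoint ℕ, 𝕂) →L[𝕂] C((M × (ι → Circle)) ⊕ OnePoint ℕ, 𝕂),
      IsIsometricShift T := by
  obtain ⟨e, he⟩ := hM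
  obtain ⟨θ, ρ, hd⟩ := exists_denseRange_circle ι hι
  exact exists_isIsometricShift_prod he θ ρ hd
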